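/- Let F be a field with char F = 0 or char F > deg f, let q ∈ F with q ≠ 0, and let f, g ∈ F[h] with deg f > 1 and g ≠ 0. Then the subgroup {φ ∈ Aut(H_q(f,g)) : φ(x) = x} is a finite cyclic group whose order divides deg f − 1; consequently Aut(H_q(f,g)) is an abelian group. -/

import Mathlib

open Polynomial

/-- The three generators `x`, `y`, `h` of a quantum generalized Heisenberg algebra. -/
inductive QGHAGen : Type
  | x : QGHAGen
  | y : QGHAGen
  | h : QGHAGen

/-- The defining relations of the quantum generalized Heisenberg algebra `H_q(f,g)`:
`h*x = x*f(h)`, `y*h = f(h)*y`, and `y*x - q*(x*y) = g(h)`. -/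
inductive QGHARel (F : Type*) [Field F] (q : F) (f g : F[X]) :
    FreeAlgebra F QGHAGen → FreeAlgebra F QGHAGen → Prop
  | hx : QGHARel F q f g
      (FreeAlgebra.ι F QGHAGen.h * FreeAlgebra.ι F QGHAGen.x)
      (FreeAlgebra.ι F QGHAGen.x * aeval (FreeAlgebra.ι F QGHAGen.h) f)
  | yh : QGHARel F q f g
      (FreeAlgebra.ι F QGHAGen.y * FreeAlgebra.ι F QGHAGen.h)
      (aeval (FreeAlgebra.ι F QGHAGen.h) f * FreeAlgebra.ι F QGHAGen.y)
  | yx : QGHARel F q f g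
      (FreeAlgebra.ι F QGHAGen.y * FreeAlgebra.ι F QGHAGen.x)
      (q • (FreeAlgebra.ι F QGHAGen.x * FreeAlgebra.ι F QGHAGen.y)
        + aeval (FreeAlgebra.ι F QGHAGen.h) g)

/-- The quantum generalized Heisenberg algebra `H_q(f,g)`. -/
def QGHA (F : Type*) [Field F] (q : F) (f g : F[X]) : Type _ :=
  RingQuot (QGHARel F q f g)

namespace QGHA

variable {F : Type*} [Field F] (q : F) (f g : F[X])

instance : Ring (QGHA F q f g) :=
  inferInstanceAs (Ring (RingQuot (QGHARel F q f g)))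

instance : Algebra F (QGHA F q f g) :=
  inferInstanceAs (Algebra F (RingQuot (QGHARel F q f g)))

/-- The generator `x` of `H_q(f,g)`. -/
def x : QGHA F q f g :=
  RingQuot.mkAlgHom F (QGHARel F q f g) (FreeAlgebra.ι F QGHAGen.x)

/-- The generator `y` of `H_q(f,g)`. -/
def y : QGHA F q f g :=
  RingQuot.mkAlgHom F (QGHARel F q f g) (FreeAlgebra.ι F QGHAGen.y)

/-- The generator `h` of `H_q(f,g)`. -/
def h : QGHA F q f g :=
  RingQuot.mkAlgHom F (QGHARel F q f g) (FreeAlgebra.ι F QGHAGen.h)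

end QGHA

namespace QGHA

variable {F : Type*} [Field F] (q : F) (f g : F[X])

/-! ### Commutation rules -/

/-- The `i`-fold composite of `f` with itself. -/
noncomputable def iter (i : ℕ) : F[X] := f.comp^[i] X

@[simp] lemma iter_zero : iter f 0 = X := rfl

lemma iter_succ (i : ℕ) : iter f (i + 1) = f.comp (iter f i) :=
  Function.iterate_succ_apply' _ _ _

lemma iter_succ' (i : ℕ) : iter f (i + 1) = (iter f i).comp f := by
  induction i with
  | zero => simp [iter_succ]
  | succ i ih => rw [iter_succ, ih, ← comp_assoc, ← iter_succ, ih]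

lemma natDegree_iter (i : ℕ) : (iter f i).natDegree = f.natDegree ^ i := by
  simp [iter]

/-- The polynomials `G i` with `y * x ^ i = q ^ i • x ^ i * y + x ^ (i - 1) * G i`. -/
noncomputable def corr : ℕ → F[X]
  | 0 => 0
  | i + 1 => C q * corr i + g.comp (iter f i)

lemma h_mul_x : h q f g * x q f g = x q f g * aeval (h q f g) f := by
  have := RingQuot.mkAlgHom_rel F (QGHARel.hx (q := q) (f := f) (g := g))
  rw [map_mul, map_mul, ← aeval_algHom_apply] at this
  exact this

lemma y_mul_h : y q f g * h q f g = aeval (h q f g) f * y q f g := by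
  have := RingQuot.mkAlgHom_rel F (QGHARel.yh (q := q) (f := f) (g := g))
  rw [map_mul, map_mul, ← aeval_algHom_apply] at this
  exact this

lemma y_mul_x : y q f g * x q f g = q • (x q f g * y q f g) + aeval (h q f g) g := by
  have := RingQuot.mkAlgHom_rel F (QGHARel.yx (q := q) (f := f) (g := g))
  rw [map_mul, map_add, map_smul, map_mul, ← aeval_algHom_apply] at this
  exact this

lemma aeval_mul_x (c : F[X]) :
    aeval (h q f g) c * x q f g = x q f g * aeval (h q f g) (c.comp f) := by
  induction c using Polynomial.induction_on' with
  | add p r hp hr => simp only [map_add, add_comp, add_mul, mul_add, hp, hr]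
  | monomial n a =>
    rw [← C_mul_X_pow_eq_monomial]
    simp only [map_mul, aeval_C, mul_comp, C_comp, map_pow, aeval_X, pow_comp, X_comp]
    have : SemiconjBy (x q f g) (aeval (h q f g) f) (h q f g) := (h_mul_x q f g).symm
    rw [mul_assoc, ← (this.pow_right n).eq, ← mul_assoc, Algebra.commutes, mul_assoc]

lemma y_mul_aeval (c : F[X]) :
    y q f g * aeval (h q f g) c = aeval (h q f g) (c.comp f) * y q f g := by
  induction c using Polynomial.induction_on' with
  | add p r hp hr => simp only [map_add, add_comp, add_mul, mul_add, hp, hr]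
  | monomial n a =>
    rw [← C_mul_X_pow_eq_monomial]
    simp only [map_mul, aeval_C, mul_comp, C_comp, map_pow, aeval_X, pow_comp, X_comp]
    have : SemiconjBy (y q f g) (h q f g) (aeval (h q f g) f) := y_mul_h q f g
    rw [mul_assoc, ← (this.pow_right n).eq, ← mul_assoc, ← Algebra.commutes, mul_assoc]

lemma aeval_mul_x_pow (c : F[X]) (i : ℕ) :
    aeval (h q f g) c * x q f g ^ i = x q f g ^ i * aeval (h q f g) (c.comp (iter f i)) := by
  induction i with
  | zero => simp
  | succ i ih =>
    rw [pow_succ, ← mul_assoc, ih, mul_assoc, aeval_mul_x, comp_assoc, ← iter_succ', mul_assoc]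

lemma y_pow_mul_aeval (c : F[X]) (k : ℕ) :
    y q f g ^ k * aeval (h q f g) c = aeval (h q f g) (c.comp (iter f k)) * y q f g ^ k := by
  induction k with
  | zero => simp
  | succ k ih =>
    rw [pow_succ', mul_assoc, ih, ← mul_assoc, y_mul_aeval, comp_assoc, ← iter_succ', mul_assoc]

lemma y_mul_x_pow (i : ℕ) :
    y q f g * x q f g ^ i = q ^ i • (x q f g ^ i * y q f g)
      + x q f g ^ (i - 1) * aeval (h q f g) (corr q f g i) := by
  induction i with
  | zero => simp [corr]
  | succ i ih =>
    have key : x q f g * (x q f g ^ (i - 1) * aeval (h q f g) (corr q f g i))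
        = x q f g ^ i * aeval (h q f g) (corr q f g i) := by
      cases i with
      | zero => simp [corr]
      | succ i => rw [← mul_assoc, ← pow_succ']; rfl
    rw [pow_succ', ← mul_assoc, y_mul_x, add_mul, smul_mul_assoc, mul_assoc, ih, aeval_mul_x_pow,
      mul_add, key]
    simp only [corr, map_add, map_mul, aeval_C, add_tsub_cancel_right, mul_add, smul_add,
      mul_smul_comm, smul_smul, pow_succ', mul_assoc, ← Algebra.smul_def, add_assoc]

/-! ### The Poincaré–Birkhoff–Witt basis -/

/-- The coefficients of an element written as `∑ x ^ i * c (h) * y ^ k`, indexed by `(i, k)`. -/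
abbrev Coeffs (F : Type*) [Field F] : Type _ := ℕ × ℕ →₀ F[X]

/-- The element `∑ x ^ i * c (h) * y ^ k` with the given coefficients. -/
noncomputable def ofCoeffs : Coeffs F →ₗ[F] QGHA F q f g :=
  Finsupp.lsum F fun d => LinearMap.mulLeft F (x q f g ^ d.1) ∘ₗ
    LinearMap.mulRight F (y q f g ^ d.2) ∘ₗ (aeval (h q f g)).toLinearMap

lemma ofCoeffs_single (d : ℕ × ℕ) (c : F[X]) :
    ofCoeffs q f g (Finsupp.single d c)
      = x q f g ^ d.1 * (aeval (h q f g) c * y q f g ^ d.2) := by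
  simp [ofCoeffs]

/-- Left multiplication by `x` on coefficients. -/
noncomputable def opX : Module.End F (Coeffs F) :=
  Finsupp.lsum F fun d => Finsupp.lsingle (d.1 + 1, d.2)

/-- Left multiplication by `h` on coefficients. -/
noncomputable def opH : Module.End F (Coeffs F) :=
  Finsupp.lsum F fun d => Finsupp.lsingle d ∘ₗ LinearMap.mulLeft F (iter f d.1)

/-- Left multiplication by `y` on coefficients. -/
noncomputable def opY : Module.End F (Coeffs F) :=
  Finsupp.lsum F fun d => Finsupp.lsingle (d.1, d.2 + 1) ∘ₗ (q ^ d.1 • (aeval f).toLinearMap)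
    + Finsupp.lsingle (d.1 - 1, d.2) ∘ₗ LinearMap.mulLeft F (corr q f g d.1)

lemma opX_single (d : ℕ × ℕ) (c : F[X]) :
    opX (Finsupp.single d c) = Finsupp.single (d.1 + 1, d.2) c := by
  simp [opX]

lemma opH_single (d : ℕ × ℕ) (c : F[X]) :
    opH f (Finsupp.single d c) = Finsupp.single d (iter f d.1 * c) := by
  simp [opH]

lemma opY_single (d : ℕ × ℕ) (c : F[X]) :
    opY q f g (Finsupp.single d c) = Finsupp.single (d.1, d.2 + 1) (q ^ d.1 • c.comp f)
      + Finsupp.single (d.1 - 1, d.2) (corr q f g d.1 * c) := by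
  simp [opY, comp, aeval_def, algebraMap_eq]

lemma aeval_opH_single (p : F[X]) (d : ℕ × ℕ) (c : F[X]) :
    aeval (opH f) p (Finsupp.single d c) = Finsupp.single d (p.comp (iter f d.1) * c) := by
  induction p using Polynomial.induction_on' with
  | add p r hp hr => simp only [map_add, add_comp, add_mul, LinearMap.add_apply, hp, hr,
      Finsupp.single_add]
  | monomial n a =>
    have : ∀ n, (opH f ^ n) (Finsupp.single d c) = Finsupp.single d (iter f d.1 ^ n * c) := by
      intro n
      induction n with
      | zero => simp
      | succ n ih => rw [pow_succ', Module.End.mul_apply, ih, opH_single, ← mul_assoc, pow_succ']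
    rw [aeval_monomial, ← Algebra.smul_def, LinearMap.smul_apply, this, Finsupp.smul_single,
      monomial_comp, smul_eq_C_mul, mul_assoc]

lemma opH_mul_opX : opH f * opX = opX * aeval (opH f) f := by
  refine Finsupp.lhom_ext fun d c => ?_
  simp only [Module.End.mul_apply, opX_single, opH_single, aeval_opH_single, iter_succ]

lemma opY_mul_opH : opY q f g * opH f = aeval (opH f) f * opY q f g := by
  refine Finsupp.lhom_ext fun d c => ?_
  simp only [Module.End.mul_apply, opY_single, opH_single, aeval_opH_single, map_add,
    mul_comp, ← iter_succ, ← iter_succ', mul_smul_comm]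
  congr 1
  rcases d with ⟨_ | i, k⟩
  · simp [corr]
  · simp only [add_tsub_cancel_right]
    rw [mul_left_comm]

lemma opY_mul_opX : opY q f g * opX = q • (opX * opY q f g) + aeval (opH f) g := by
  refine Finsupp.lhom_ext fun d c => ?_
  simp only [Module.End.mul_apply, LinearMap.add_apply, LinearMap.smul_apply, opX_single,
    opY_single, aeval_opH_single, map_add, smul_add, Finsupp.smul_single, smul_smul,
    ← pow_succ', add_tsub_cancel_right, add_assoc]
  congr 1
  rcases d with ⟨_ | i, k⟩
  · simp [corr]
  · simp only [add_tsub_cancel_right, ← Finsupp.single_add]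
    rw [corr, add_mul, smul_eq_C_mul, mul_assoc]

/-- The action of `H_q(f,g)` on coefficients by left multiplication. -/
noncomputable def leftAction : QGHA F q f g →ₐ[F] Module.End F (Coeffs F) :=
  RingQuot.liftAlgHom F ⟨FreeAlgebra.lift F fun
      | QGHAGen.x => opX
      | QGHAGen.y => opY q f g
      | QGHAGen.h => opH f, by
    intro a b hab
    cases hab
    · simpa [← aeval_algHom_apply] using opH_mul_opX f
    · simpa [← aeval_algHom_apply] using opY_mul_opH q f g
    · simpa [← aeval_algHom_apply] using opY_mul_opX q f g⟩

@[simp] lemma leftAction_x : leftAction q f g (x q f g) = opX :=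
  (RingQuot.liftAlgHom_mkAlgHom_apply F _ _ _).trans (FreeAlgebra.lift_ι_apply _ _)

@[simp] lemma leftAction_y : leftAction q f g (y q f g) = opY q f g :=
  (RingQuot.liftAlgHom_mkAlgHom_apply F _ _ _).trans (FreeAlgebra.lift_ι_apply _ _)

@[simp] lemma leftAction_h : leftAction q f g (h q f g) = opH f :=
  (RingQuot.liftAlgHom_mkAlgHom_apply F _ _ _).trans (FreeAlgebra.lift_ι_apply _ _)

variable {q f g} in
@[elab_as_elim]
lemma induction {P : QGHA F q f g → Prop} (hc : ∀ r, P (algebraMap F _ r))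
    (hx : P (x q f g)) (hy : P (y q f g)) (hh : P (h q f g))
    (hmul : ∀ a b, P a → P b → P (a * b)) (hadd : ∀ a b, P a → P b → P (a + b))
    (u : QGHA F q f g) : P u := by
  obtain ⟨u, rfl⟩ := RingQuot.mkAlgHom_surjective F (QGHARel F q f g) u
  induction u using FreeAlgebra.induction with
  | grade0 r =>
    rw [AlgHom.commutes]
    exact hc r
  | grade1 t => cases t <;> assumption
  | mul a b ha hb =>
    rw [map_mul]
    exact hmul _ _ ha hb
  | add a b ha hb =>
    rw [map_add]
    exact hadd _ _ ha hb

lemma ofCoeffs_opX (v : Coeffs F) : ofCoeffs q f g (opX v) = x q f g * ofCoeffs q f g v := by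
  induction v using Finsupp.induction_linear with
  | zero => simp
  | add v w hv hw => simp only [map_add, mul_add, hv, hw]
  | single d c => rw [opX_single, ofCoeffs_single, ofCoeffs_single, pow_succ', mul_assoc]

lemma ofCoeffs_opH (v : Coeffs F) : ofCoeffs q f g (opH f v) = h q f g * ofCoeffs q f g v := by
  induction v using Finsupp.induction_linear with
  | zero => simp
  | add v w hv hw => simp only [map_add, mul_add, hv, hw]
  | single d c =>
    have := aeval_mul_x_pow q f g X d.1
    rw [aeval_X, X_comp] at this
    rw [opH_single, ofCoeffs_single, ofCoeffs_single, ← mul_assoc (h q f g), this, map_mul]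
    simp only [mul_assoc]

lemma ofCoeffs_opY (v : Coeffs F) :
    ofCoeffs q f g (opY q f g v) = y q f g * ofCoeffs q f g v := by
  induction v using Finsupp.induction_linear with
  | zero => simp
  | add v w hv hw => simp only [map_add, mul_add, hv, hw]
  | single d c =>
    rw [opY_single, map_add, ofCoeffs_single, ofCoeffs_single, ofCoeffs_single,
      ← mul_assoc (y q f g), y_mul_x_pow, add_mul, smul_mul_assoc, mul_assoc _ (y q f g),
      ← mul_assoc (y q f g), y_mul_aeval, map_smul, map_mul, pow_succ']
    simp only [mul_assoc, smul_mul_assoc, mul_smul_comm]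

variable {q f g} in
lemma ofCoeffs_leftAction (u : QGHA F q f g) (v : Coeffs F) :
    ofCoeffs q f g (leftAction q f g u v) = u * ofCoeffs q f g v := by
  induction u using QGHA.induction generalizing v with
  | hc r => rw [AlgHom.commutes, Module.algebraMap_end_apply, map_smul, Algebra.smul_def]
  | hx => rw [leftAction_x, ofCoeffs_opX]
  | hy => rw [leftAction_y, ofCoeffs_opY]
  | hh => rw [leftAction_h, ofCoeffs_opH]
  | hmul a b ha hb => rw [map_mul, Module.End.mul_apply, ha, hb, mul_assoc]
  | hadd a b ha hb => rw [map_add, LinearMap.add_apply, map_add, ha, hb, add_mul]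

/-- The coefficients of an element of `H_q(f,g)`. -/
noncomputable def coeffs : QGHA F q f g →ₗ[F] Coeffs F :=
  LinearMap.applyₗ (Finsupp.single 0 1) ∘ₗ (leftAction q f g).toLinearMap

variable {q f g}

lemma coeffs_def (u : QGHA F q f g) :
    coeffs q f g u = leftAction q f g u (Finsupp.single 0 1) := rfl

lemma ofCoeffs_coeffs (u : QGHA F q f g) : ofCoeffs q f g (coeffs q f g u) = u := by
  rw [coeffs_def, ofCoeffs_leftAction, ofCoeffs_single]
  simp

lemma coeffs_ofCoeffs (v : Coeffs F) : coeffs q f g (ofCoeffs q f g v) = v := by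
  induction v using Finsupp.induction_linear with
  | zero => simp
  | add v w hv hw => simp only [map_add, hv, hw]
  | single d c =>
    have hy : ∀ k, (opY q f g ^ k) (Finsupp.single 0 1) = Finsupp.single (0, k) 1 := by
      intro k
      induction k with
      | zero => rfl
      | succ k ih => simp [pow_succ', ih, opY_single, corr]
    have hx : ∀ i k, (opX ^ i) (Finsupp.single (0, k) c) = Finsupp.single (i, k) c := by
      intro i k
      induction i with
      | zero => simp
      | succ i ih => rw [pow_succ', Module.End.mul_apply, ih, opX_single]
    rw [ofCoeffs_single, coeffs_def]
    simp only [map_mul, map_pow, leftAction_x, leftAction_y, Module.End.mul_apply, hy,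
      ← aeval_algHom_apply, leftAction_h, aeval_opH_single]
    simp [hx]

lemma coeffs_injective : Function.Injective (coeffs q f g) :=
  Function.LeftInverse.injective ofCoeffs_coeffs

lemma coeffs_mul (u w : QGHA F q f g) :
    coeffs q f g (u * w) = leftAction q f g u (coeffs q f g w) := by
  rw [coeffs_def, map_mul, Module.End.mul_apply, coeffs_def]

lemma coeffs_aeval_mul (c : F[X]) (u : QGHA F q f g) (d : ℕ × ℕ) :
    coeffs q f g (aeval (h q f g) c * u) d = c.comp (iter f d.1) * coeffs q f g u d := by
  rw [coeffs_mul, ← aeval_algHom_apply, leftAction_h]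
  induction coeffs q f g u using Finsupp.induction_linear with
  | zero => simp
  | add v w hv hw => simp only [map_add, Finsupp.add_apply, mul_add, hv, hw]
  | single e a =>
    rw [aeval_opH_single]
    by_cases hed : e = d
    · simp [hed]
    · simp [Finsupp.single_eq_of_ne' hed]

lemma coeffs_mul_aeval (c : F[X]) (u : QGHA F q f g) (d : ℕ × ℕ) :
    coeffs q f g (u * aeval (h q f g) c) d = coeffs q f g u d * c.comp (iter f d.2) := by
  obtain ⟨v, rfl⟩ : ∃ v, ofCoeffs q f g v = u := ⟨_, ofCoeffs_coeffs u⟩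
  induction v using Finsupp.induction_linear with
  | zero => simp
  | add v w hv hw => simp only [map_add, Finsupp.add_apply, add_mul, hv, hw]
  | single e a =>
    have : ofCoeffs q f g (Finsupp.single e a) * aeval (h q f g) c
        = ofCoeffs q f g (Finsupp.single e (a * c.comp (iter f e.2))) := by
      rw [ofCoeffs_single, ofCoeffs_single, mul_assoc, mul_assoc, y_pow_mul_aeval, map_mul,
        mul_assoc]
    rw [this, coeffs_ofCoeffs, coeffs_ofCoeffs]
    by_cases hed : e = d
    · simp [hed]
    · simp [Finsupp.single_eq_of_ne' hed]

lemma coeffs_aeval (c : F[X]) : coeffs q f g (aeval (h q f g) c) = Finsupp.single 0 c := by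
  rw [← coeffs_ofCoeffs (q := q) (f := f) (g := g) (Finsupp.single 0 c), ofCoeffs_single]
  simp

lemma aeval_h_injective : Function.Injective (aeval (R := F) (h q f g)) := by
  intro a b hab
  have := congr_arg (coeffs q f g) hab
  rw [coeffs_aeval, coeffs_aeval] at this
  exact Finsupp.single_injective _ this

/-! ### The leading exponent -/

/-- `v` has leading exponent `d` in the lexicographic order. -/
def IsLead (v : Coeffs F) (d : ℕ × ℕ) : Prop :=
  v d ≠ 0 ∧ ∀ e, toLex d < toLex e → v e = 0

lemma IsLead.unique {v : Coeffs F} {d e : ℕ × ℕ} (hd : IsLead v d) (he : IsLead v e) :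
    d = e := by
  rcases lt_trichotomy (toLex d) (toLex e) with hlt | heq | hlt
  · exact absurd (hd.2 e hlt) he.1
  · exact toLex.injective heq
  · exact absurd (he.2 d hlt) hd.1

lemma exists_isLead {v : Coeffs F} (hv : v ≠ 0) : ∃ d, IsLead v d := by
  obtain ⟨d, hd, hmax⟩ := v.support.exists_max_image toLex (Finsupp.support_nonempty_iff.2 hv)
  refine ⟨d, Finsupp.mem_support_iff.1 hd, fun e he => ?_⟩
  by_contra hne
  exact absurd (hmax e (Finsupp.mem_support_iff.2 hne)) (not_le.2 he)

lemma isLead_single (d : ℕ × ℕ) {c : F[X]} (hc : c ≠ 0) : IsLead (Finsupp.single d c) d := by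
  refine ⟨by simpa, fun e he => Finsupp.single_eq_of_ne ?_⟩
  rintro rfl
  exact lt_irrefl _ he

lemma opX_apply_succ (v : Coeffs F) (i k : ℕ) : opX v (i + 1, k) = v (i, k) := by
  induction v using Finsupp.induction_linear with
  | zero => simp
  | add v w hv hw => simp only [map_add, Finsupp.add_apply, hv, hw]
  | single d c => simp [opX_single, Finsupp.single_apply, Prod.ext_iff]

lemma opX_apply_zero (v : Coeffs F) (k : ℕ) : opX v (0, k) = 0 := by
  induction v using Finsupp.induction_linear with
  | zero => simp
  | add v w hv hw => simp only [map_add, Finsupp.add_apply, hv, hw, add_zero]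
  | single d c => simp [opX_single]

lemma opY_apply_succ (v : Coeffs F) (i k : ℕ) :
    opY q f g v (i, k + 1)
      = q ^ i • (v (i, k)).comp f + corr q f g (i + 1) * v (i + 1, k + 1) := by
  induction v using Finsupp.induction_linear with
  | zero => simp
  | add v w hv hw =>
    simp only [map_add, Finsupp.add_apply, hv, hw, add_comp, mul_add, smul_add]
    abel
  | single d c =>
    obtain ⟨_ | a, b⟩ := d <;>
    simp only [opY_single, Finsupp.add_apply, Finsupp.single_apply, Prod.mk.injEq,
      add_tsub_cancel_right, add_left_inj] <;> split_ifs <;> simp_all [corr]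

lemma opY_apply_zero (v : Coeffs F) (i : ℕ) :
    opY q f g v (i, 0) = corr q f g (i + 1) * v (i + 1, 0) := by
  induction v using Finsupp.induction_linear with
  | zero => simp
  | add v w hv hw => simp only [map_add, Finsupp.add_apply, hv, hw, mul_add]
  | single d c =>
    obtain ⟨_ | a, b⟩ := d <;>
    simp only [opY_single, Finsupp.add_apply, Finsupp.single_apply, Prod.mk.injEq,
      add_tsub_cancel_right, add_left_inj] <;> split_ifs <;> simp_all [corr]

lemma comp_ne_zero_of_natDegree_ne_zero {c p : F[X]} (hc : c ≠ 0) (hp : p.natDegree ≠ 0) :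
    c.comp p ≠ 0 := by
  rw [Ne, comp_eq_zero_iff]
  rintro (h0 | ⟨-, h0⟩)
  · exact hc h0
  · exact hp (by rw [h0, natDegree_C])

lemma natDegree_iter_ne_zero (hf : f.natDegree ≠ 0) (i : ℕ) : (iter f i).natDegree ≠ 0 := by
  rw [natDegree_iter]
  exact pow_ne_zero _ hf

lemma IsLead.opX {v : Coeffs F} {d : ℕ × ℕ} (hv : IsLead v d) :
    IsLead (opX v) ((1, 0) + d) := by
  obtain ⟨i, k⟩ := d
  rw [Prod.mk_add_mk, zero_add, add_comm]
  refine ⟨by rw [opX_apply_succ]; exact hv.1, ?_⟩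
  rintro ⟨_ | a, b⟩ he
  · exact opX_apply_zero _ _
  · rw [opX_apply_succ]
    refine hv.2 _ ?_
    rw [Prod.Lex.toLex_lt_toLex] at he ⊢
    simp only at he ⊢
    omega

lemma IsLead.opY (hq : q ≠ 0) (hf : f.natDegree ≠ 0) {v : Coeffs F} {d : ℕ × ℕ}
    (hv : IsLead v d) : IsLead (opY q f g v) ((0, 1) + d) := by
  obtain ⟨i, k⟩ := d
  rw [Prod.mk_add_mk, zero_add, add_comm]
  have hsmall : ∀ a b, toLex (i, k) < toLex (a, b) → v (a, b) = 0 := fun a b => hv.2 (a, b)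
  simp only [Prod.Lex.toLex_lt_toLex] at hsmall
  constructor
  · rw [opY_apply_succ, hsmall (i + 1) (k + 1) (by omega), mul_zero, add_zero]
    exact smul_ne_zero (pow_ne_zero _ hq) (comp_ne_zero_of_natDegree_ne_zero hv.1 hf)
  · rintro ⟨a, _ | b⟩ he <;> rw [Prod.Lex.toLex_lt_toLex] at he <;> simp only at he
    · rw [opY_apply_zero, hsmall _ _ (by omega), mul_zero]
    · rw [opY_apply_succ, hsmall _ _ (by omega), hsmall _ _ (by omega)]
      simp

/-- An element of `H_q(f,g)` has leading exponent `d`. -/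
def HasLead (u : QGHA F q f g) (d : ℕ × ℕ) : Prop := IsLead (coeffs q f g u) d

lemma IsLead.aeval_opH (hf : f.natDegree ≠ 0) {v : Coeffs F} {d : ℕ × ℕ} {c : F[X]} (hc : c ≠ 0)
    (hv : IsLead v d) : IsLead (aeval (opH f) c v) d := by
  have key : ∀ e, aeval (opH f) c v e = c.comp (iter f e.1) * v e := fun e => by
    have := coeffs_aeval_mul (q := (0 : F)) (g := (0 : F[X])) c (ofCoeffs 0 f 0 v) e
    rwa [coeffs_mul, ← aeval_algHom_apply, leftAction_h, coeffs_ofCoeffs] at this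
  refine ⟨?_, fun e he => by rw [key, hv.2 e he, mul_zero]⟩
  rw [key]
  exact mul_ne_zero (comp_ne_zero_of_natDegree_ne_zero hc (natDegree_iter_ne_zero hf _)) hv.1

lemma IsLead.leftAction_monomial (hq : q ≠ 0) (hf : f.natDegree ≠ 0) {v : Coeffs F}
    {d : ℕ × ℕ} (hv : IsLead v d) (e : ℕ × ℕ) {c : F[X]} (hc : c ≠ 0) :
    IsLead (leftAction q f g (ofCoeffs q f g (Finsupp.single e c)) v) (e + d) := by
  have hy : ∀ k, IsLead ((QGHA.opY q f g ^ k) v) ((0, k) + d) := by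
    intro k
    induction k with
    | zero => rwa [pow_zero, Module.End.one_apply, Prod.mk_zero_zero, zero_add]
    | succ k ih =>
      rw [pow_succ', Module.End.mul_apply]
      convert ih.opY hq hf using 1
      exact Prod.ext (by simp) (by simp; omega)
  have hx : ∀ i w e, IsLead w e → IsLead ((QGHA.opX (F := F) ^ i) w) ((i, 0) + e) := by
    intro i w e hw
    induction i with
    | zero => rwa [pow_zero, Module.End.one_apply, Prod.mk_zero_zero, zero_add]
    | succ k ih =>
      rw [pow_succ', Module.End.mul_apply]
      convert ih.opX using 1
      exact Prod.ext (by simp; omega) (by simp)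
  rw [ofCoeffs_single]
  simp only [map_mul, map_pow, leftAction_x, leftAction_y, Module.End.mul_apply,
    ← aeval_algHom_apply, leftAction_h]
  convert hx e.1 _ _ ((hy e.2).aeval_opH hf hc) using 1
  exact Prod.ext (by simp) (by simp)

lemma HasLead.mul (hq : q ≠ 0) (hf : f.natDegree ≠ 0) {u w : QGHA F q f g} {d e : ℕ × ℕ}
    (hu : HasLead u d) (hw : HasLead w e) : HasLead (u * w) (d + e) := by
  have hmono : ∀ a c, c ≠ 0 → IsLead (leftAction q f g (ofCoeffs q f g (Finsupp.single a c))
      (coeffs q f g w)) (a + e) := fun a c hc => IsLead.leftAction_monomial hq hf hw a hc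
  have hsum : ∀ t, coeffs q f g (u * w) t = ∑ a ∈ (coeffs q f g u).support,
      leftAction q f g (ofCoeffs q f g (Finsupp.single a (coeffs q f g u a)))
        (coeffs q f g w) t := by
    intro t
    conv_lhs => rw [coeffs_mul, ← ofCoeffs_coeffs u, ← Finsupp.sum_single (coeffs q f g u)]
    rw [Finsupp.sum, map_sum, map_sum, LinearMap.sum_apply, Finsupp.finsetSum_apply]
  have hle : ∀ a ∈ (coeffs q f g u).support, toLex a ≤ toLex d := fun a ha =>
    not_lt.1 fun hlt => Finsupp.mem_support_iff.1 ha (hu.2 a hlt)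
  unfold HasLead
  constructor
  · rw [hsum, Finset.sum_eq_single d]
    · exact (hmono d _ hu.1).1
    · intro a ha had
      refine (hmono a _ (Finsupp.mem_support_iff.1 ha)).2 _ ?_
      have hlt : toLex a < toLex d := lt_of_le_of_ne (hle a ha) (toLex.injective.ne had)
      simpa only [toLex_add] using add_lt_add_left hlt (toLex e)
    · intro hd
      exact absurd (Finsupp.mem_support_iff.2 hu.1) hd
  · intro t ht
    rw [hsum]
    refine Finset.sum_eq_zero fun a ha => (hmono a _ (Finsupp.mem_support_iff.1 ha)).2 _ ?_
    refine lt_of_le_of_lt ?_ ht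
    simpa only [toLex_add] using add_le_add_left (hle a ha) (toLex e)

lemma HasLead.ne_zero {u : QGHA F q f g} {d : ℕ × ℕ} (hu : HasLead u d) : u ≠ 0 := by
  rintro rfl
  exact hu.1 (by simp)

lemma exists_hasLead {u : QGHA F q f g} (hu : u ≠ 0) : ∃ d, HasLead u d :=
  exists_isLead ((map_ne_zero_iff _ coeffs_injective).2 hu)

lemma HasLead.add_of_lt {u w : QGHA F q f g} {d e : ℕ × ℕ} (hu : HasLead u d) (hw : HasLead w e)
    (hlt : toLex e < toLex d) : HasLead (u + w) d := by
  unfold HasLead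
  rw [map_add]
  refine ⟨?_, fun t ht => ?_⟩
  · rw [Finsupp.add_apply, hw.2 d hlt, add_zero]
    exact hu.1
  · rw [Finsupp.add_apply, hu.2 t ht, hw.2 t (hlt.trans ht), add_zero]

lemma hasLead_aeval {c : F[X]} (hc : c ≠ 0) : HasLead (aeval (h q f g) c) 0 := by
  rw [HasLead, coeffs_aeval]
  exact isLead_single 0 hc

lemma toLex_zero_lt {d : ℕ × ℕ} (hd : d ≠ 0) : toLex 0 < toLex d := by
  rw [Prod.Lex.toLex_lt_toLex]
  obtain ⟨i, k⟩ := d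
  simp only [ne_eq, Prod.mk_eq_zero, Prod.fst_zero, Prod.snd_zero] at hd ⊢
  omega

lemma HasLead.exists_aeval {u : QGHA F q f g} (hu : HasLead u 0) :
    ∃ c : F[X], c ≠ 0 ∧ u = aeval (h q f g) c := by
  refine ⟨_, hu.1, coeffs_injective ?_⟩
  rw [coeffs_aeval]
  ext1 d
  rcases eq_or_ne d 0 with rfl | hd
  · simp
  · rw [hu.2 d (toLex_zero_lt hd), Finsupp.single_eq_of_ne hd]

lemma HasLead.aeval (hq : q ≠ 0) (hf : f.natDegree ≠ 0) {u : QGHA F q f g} {d : ℕ × ℕ}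
    (hu : HasLead u d) (hd : d ≠ 0) (n : ℕ) {p : F[X]} (hp : p ≠ 0) (hn : p.natDegree = n) :
    HasLead (aeval u p) (n • d) := by
  induction n generalizing p with
  | zero =>
    rw [eq_C_of_natDegree_eq_zero hn, aeval_C, zero_smul, ← aeval_C (h q f g)]
    refine hasLead_aeval ?_
    rw [← eq_C_of_natDegree_eq_zero hn]
    exact hp
  | succ n ih =>
    have hdeg : p.divX.natDegree = n := by rw [natDegree_divX_eq_natDegree_tsub_one, hn]; rfl
    have hdiv : p.divX ≠ 0 := by
      intro h0
      rw [divX_eq_zero_iff] at h0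
      rw [h0, natDegree_C] at hn
      omega
    have hmain := (ih hdiv hdeg).mul hq hf hu
    rw [← succ_nsmul] at hmain
    rw [← divX_mul_X_add p, map_add, map_mul, aeval_X, aeval_C]
    rcases eq_or_ne (p.coeff 0) 0 with h0 | h0
    · rwa [h0, map_zero, add_zero]
    · rw [← aeval_C (h q f g)]
      refine hmain.add_of_lt (hasLead_aeval (C_ne_zero.2 h0)) (toLex_zero_lt ?_)
      exact smul_ne_zero n.succ_ne_zero hd

lemma mul_ne_zero_of_ne_zero (hq : q ≠ 0) (hf : f.natDegree ≠ 0) {u w : QGHA F q f g}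
    (hu : u ≠ 0) (hw : w ≠ 0) : u * w ≠ 0 := by
  obtain ⟨d, hd⟩ := exists_hasLead hu
  obtain ⟨e, he⟩ := exists_hasLead hw
  exact (hd.mul hq hf he).ne_zero

lemma noZeroDivisors (hq : q ≠ 0) (hf : f.natDegree ≠ 0) : NoZeroDivisors (QGHA F q f g) :=
  ⟨fun {u w} huw => by
    by_contra! hne
    exact mul_ne_zero_of_ne_zero hq hf hne.1 hne.2 huw⟩

lemma exists_scalar_of_mul_eq_one (hq : q ≠ 0) (hf : f.natDegree ≠ 0) {u w : QGHA F q f g}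
    (huw : u * w = 1) :
    ∃ a : F, a ≠ 0 ∧ u = algebraMap F _ a ∧ w = algebraMap F _ a⁻¹ := by
  have h1 : HasLead (1 : QGHA F q f g) 0 := by
    rw [← map_one (Polynomial.aeval (R := F) (h q f g))]
    exact hasLead_aeval one_ne_zero
  have hne := huw ▸ h1.ne_zero
  obtain ⟨d, hd⟩ := exists_hasLead (left_ne_zero_of_mul hne)
  obtain ⟨e, he⟩ := exists_hasLead (right_ne_zero_of_mul hne)
  have hde : d + e = 0 := (huw ▸ hd.mul hq hf he).unique h1
  rw [add_eq_zero] at hde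
  obtain ⟨rfl, rfl⟩ := hde
  obtain ⟨c, -, rfl⟩ := hd.exists_aeval
  obtain ⟨c', -, rfl⟩ := he.exists_aeval
  rw [← map_mul, ← map_one (Polynomial.aeval (R := F) (h q f g))] at huw
  have hc := aeval_h_injective huw
  obtain ⟨a, ha, hac⟩ := isUnit_iff.1 (IsUnit.of_mul_eq_one _ hc)
  have ha0 := ha.ne_zero
  refine ⟨a, ha0, by rw [← hac, aeval_C], ?_⟩
  rw [← aeval_C (h q f g)]
  congr 1
  apply mul_left_cancel₀ (C_ne_zero.2 ha0)
  rw [hac, hc, ← hac, ← C_mul, mul_inv_cancel₀ ha0, C_1]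

/-! ### Automorphisms -/

lemma coeffs_mul_coeffs_eq_zero {a p : F[X]} {u : QGHA F q f g}
    (hu : aeval (h q f g) a * u = u * aeval (h q f g) p) {i k : ℕ}
    (hik : (a.comp (iter f i)).natDegree ≠ (p.comp (iter f k)).natDegree) :
    coeffs q f g u (i, k) = 0 := by
  have hc := congr_arg (fun v => coeffs q f g v (i, k)) hu
  simp only [coeffs_aeval_mul, coeffs_mul_aeval] at hc
  rw [mul_comm] at hc
  by_contra h0
  exact hik (congr_arg natDegree (mul_left_cancel₀ h0 hc))

lemma natDegree_comp_iter (p : F[X]) (i : ℕ) :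
    (p.comp (iter f i)).natDegree = p.natDegree * f.natDegree ^ i := by
  rw [natDegree_comp, natDegree_iter]

lemma exists_eq_x_mul (hf : 1 < f.natDegree) {a p : F[X]} (ha : a.natDegree = 1)
    (hp : p.natDegree = f.natDegree) {u : QGHA F q f g}
    (hu : aeval (h q f g) a * u = u * aeval (h q f g) p) : ∃ w, u = x q f g * w := by
  have hmem : u ∈ LinearMap.range (LinearMap.mulLeft F (x q f g)) := by
    rw [← ofCoeffs_coeffs u, ← Finsupp.sum_single (coeffs q f g u), Finsupp.sum, map_sum]
    refine Submodule.sum_mem _ fun d hd => ?_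
    obtain ⟨_ | i, k⟩ := d
    · refine absurd (coeffs_mul_coeffs_eq_zero hu ?_) (Finsupp.mem_support_iff.1 hd)
      rw [natDegree_comp_iter, natDegree_comp_iter, ha, hp, ← pow_succ', one_mul]
      exact (Nat.pow_right_injective hf).ne (by simp)
    · rw [ofCoeffs_single, pow_succ', mul_assoc]
      exact ⟨_, rfl⟩
  obtain ⟨w, hw⟩ := hmem
  exact ⟨w, hw.symm⟩

lemma exists_eq_mul_y (hf : 1 < f.natDegree) {a p : F[X]} (ha : a.natDegree = 1)
    (hp : p.natDegree = f.natDegree) {u : QGHA F q f g}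
    (hu : aeval (h q f g) p * u = u * aeval (h q f g) a) : ∃ w, u = w * y q f g := by
  have hmem : u ∈ LinearMap.range (LinearMap.mulRight F (y q f g)) := by
    rw [← ofCoeffs_coeffs u, ← Finsupp.sum_single (coeffs q f g u), Finsupp.sum, map_sum]
    refine Submodule.sum_mem _ fun d hd => ?_
    obtain ⟨i, _ | k⟩ := d
    · refine absurd (coeffs_mul_coeffs_eq_zero hu ?_) (Finsupp.mem_support_iff.1 hd)
      rw [natDegree_comp_iter, natDegree_comp_iter, ha, hp, ← pow_succ', one_mul]
      exact (Nat.pow_right_injective hf).ne (by simp)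
    · rw [ofCoeffs_single, pow_succ, ← mul_assoc, ← mul_assoc]
      exact ⟨_, rfl⟩
  obtain ⟨w, hw⟩ := hmem
  exact ⟨w, hw.symm⟩

lemma x_ne_zero : x q f g ≠ 0 := by
  have hx : x q f g = ofCoeffs q f g (Finsupp.single (1, 0) 1) := by simp [ofCoeffs_single]
  intro h0
  have := congr_arg (coeffs q f g) (hx.symm.trans h0)
  simp [coeffs_ofCoeffs] at this

lemma y_ne_zero : y q f g ≠ 0 := by
  have hy : y q f g = ofCoeffs q f g (Finsupp.single (0, 1) 1) := by simp [ofCoeffs_single]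
  intro h0
  have := congr_arg (coeffs q f g) (hy.symm.trans h0)
  simp [coeffs_ofCoeffs] at this

lemma h_ne_zero : h q f g ≠ 0 := by
  rw [← aeval_X (R := F) (h q f g), Ne, map_eq_zero_iff _ aeval_h_injective]
  exact X_ne_zero

lemma algEquiv_h_mul_x (φ : QGHA F q f g ≃ₐ[F] QGHA F q f g) :
    φ (h q f g) * φ (x q f g) = φ (x q f g) * aeval (φ (h q f g)) f := by
  rw [← map_mul, h_mul_x, map_mul, aeval_algHom_apply]

lemma algEquiv_y_mul_h (φ : QGHA F q f g ≃ₐ[F] QGHA F q f g) :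
    φ (y q f g) * φ (h q f g) = aeval (φ (h q f g)) f * φ (y q f g) := by
  rw [← map_mul, y_mul_h, map_mul, aeval_algHom_apply]

lemma algEquiv_h_eq_aeval (hq : q ≠ 0) (hf : 1 < f.natDegree)
    (φ : QGHA F q f g ≃ₐ[F] QGHA F q f g) : ∃ c : F[X], φ (h q f g) = aeval (h q f g) c := by
  have hf0 : f.natDegree ≠ 0 := by omega
  obtain ⟨d, hd⟩ := exists_hasLead ((map_ne_zero_iff φ φ.injective).2 (h_ne_zero (q := q)))
  obtain ⟨e, he⟩ := exists_hasLead ((map_ne_zero_iff φ φ.injective).2 (x_ne_zero (q := q)))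
  have hd0 : d = 0 := by
    by_contra hd0
    have hfne : f ≠ 0 := by
      rintro rfl
      simp at hf0
    have h1 := hd.mul hq hf0 he
    rw [algEquiv_h_mul_x] at h1
    have h2 := h1.unique (he.mul hq hf0 (hd.aeval hq hf0 hd0 _ hfne rfl))
    rw [add_comm, add_right_inj] at h2
    obtain ⟨i, k⟩ := d
    simp only [Prod.smul_mk, smul_eq_mul, Prod.mk.injEq] at h2
    refine hd0 ?_
    have : ∀ m, m = f.natDegree * m → m = 0 := fun m hm => by nlinarith
    rw [this i h2.1, this k h2.2]
    rfl
  subst hd0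
  obtain ⟨c, -, hc⟩ := hd.exists_aeval
  exact ⟨c, hc⟩

lemma algEquiv_h (hq : q ≠ 0) (hf : 1 < f.natDegree) (φ : QGHA F q f g ≃ₐ[F] QGHA F q f g) :
    ∃ c : F[X], c.natDegree = 1 ∧ φ (h q f g) = aeval (h q f g) c := by
  obtain ⟨c, hc⟩ := algEquiv_h_eq_aeval hq hf φ
  obtain ⟨c', hc'⟩ := algEquiv_h_eq_aeval hq hf φ.symm
  refine ⟨c, ?_, hc⟩
  have hX : c'.comp c = X := by
    apply aeval_h_injective (q := q) (f := f) (g := g)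
    rw [aeval_comp, ← hc, aeval_algHom_apply, ← hc', AlgEquiv.apply_symm_apply, aeval_X]
  have := congr_arg natDegree hX
  rw [natDegree_comp, natDegree_X] at this
  exact Nat.eq_one_of_mul_eq_one_left this

lemma algEquiv_x_eq_mul (hq : q ≠ 0) (hf : 1 < f.natDegree)
    (φ : QGHA F q f g ≃ₐ[F] QGHA F q f g) : ∃ w, φ (x q f g) = x q f g * w := by
  obtain ⟨c, hc1, hc⟩ := algEquiv_h hq hf φ
  have hrel := algEquiv_h_mul_x φ
  rw [hc, ← aeval_comp] at hrel
  exact exists_eq_x_mul hf hc1 (by rw [natDegree_comp, hc1, mul_one]) hrel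

lemma algEquiv_y_eq_mul (hq : q ≠ 0) (hf : 1 < f.natDegree)
    (φ : QGHA F q f g ≃ₐ[F] QGHA F q f g) : ∃ w, φ (y q f g) = w * y q f g := by
  obtain ⟨c, hc1, hc⟩ := algEquiv_h hq hf φ
  have hrel := algEquiv_y_mul_h φ
  rw [hc, ← aeval_comp] at hrel
  exact exists_eq_mul_y hf hc1 (by rw [natDegree_comp, hc1, mul_one]) hrel.symm

lemma algEquiv_x (hq : q ≠ 0) (hf : 1 < f.natDegree) (φ : QGHA F q f g ≃ₐ[F] QGHA F q f g) :
    ∃ a : F, a ≠ 0 ∧ φ (x q f g) = a • x q f g := by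
  have hf0 : f.natDegree ≠ 0 := by omega
  have := noZeroDivisors (g := g) hq hf0
  obtain ⟨v, hv⟩ := algEquiv_x_eq_mul hq hf φ
  obtain ⟨w, hw⟩ := algEquiv_x_eq_mul hq hf φ.symm
  have hx : x q f g * (v * φ w) = x q f g * 1 := by
    rw [← mul_assoc, ← hv, ← map_mul, ← hw, AlgEquiv.apply_symm_apply, mul_one]
  obtain ⟨a, ha, hva, -⟩ :=
    exists_scalar_of_mul_eq_one hq hf0 (mul_left_cancel₀ x_ne_zero hx)
  exact ⟨a, ha, by rw [hv, hva, ← Algebra.commutes, Algebra.smul_def]⟩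

lemma algEquiv_y (hq : q ≠ 0) (hf : 1 < f.natDegree) (φ : QGHA F q f g ≃ₐ[F] QGHA F q f g) :
    ∃ a : F, φ (y q f g) = a • y q f g := by
  have hf0 : f.natDegree ≠ 0 := by omega
  have := noZeroDivisors (g := g) hq hf0
  obtain ⟨v, hv⟩ := algEquiv_y_eq_mul hq hf φ
  obtain ⟨w, hw⟩ := algEquiv_y_eq_mul hq hf φ.symm
  have hy : (φ w * v) * y q f g = 1 * y q f g := by
    rw [mul_assoc, ← hv, ← map_mul, ← hw, AlgEquiv.apply_symm_apply, one_mul]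
  obtain ⟨a, -, -, hva⟩ :=
    exists_scalar_of_mul_eq_one hq hf0 (mul_right_cancel₀ y_ne_zero hy)
  exact ⟨a⁻¹, by rw [hv, hva, Algebra.smul_def]⟩

/-- The affine map `X ↦ a * X + b` is invertible and commutes with `f` under composition. -/
def IsAffineSymm (f : F[X]) (a b : F) : Prop :=
  a ≠ 0 ∧ f.comp (C a * X + C b) = C a * f + C b

lemma algEquiv_h_affine (hq : q ≠ 0) (hf : 1 < f.natDegree)
    (φ : QGHA F q f g ≃ₐ[F] QGHA F q f g) :
    ∃ a b : F, IsAffineSymm f a b ∧ φ (h q f g) = a • h q f g + algebraMap F _ b := by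
  have hf0 : f.natDegree ≠ 0 := by omega
  have := noZeroDivisors (g := g) hq hf0
  obtain ⟨c, hc1, hc⟩ := algEquiv_h hq hf φ
  obtain ⟨a, b, rfl⟩ := exists_eq_X_add_C_of_natDegree_le_one hc1.le
  refine ⟨a, b, ⟨?_, ?_⟩, ?_⟩
  · rintro rfl
    simp at hc1
  · obtain ⟨t, ht, hx⟩ := algEquiv_x hq hf φ
    have hrel := algEquiv_h_mul_x φ
    rw [hc, hx, ← aeval_comp, mul_smul_comm, smul_mul_assoc, aeval_mul_x] at hrel
    have hfc := aeval_h_injective (mul_left_cancel₀ x_ne_zero (smul_right_injective _ ht hrel))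
    rw [← hfc]
    simp
  · rw [hc]
    simp [Algebra.smul_def]

lemma eq_zero_of_comp_X_add_C (hf : 1 < f.natDegree) (hn : (f.natDegree : F) ≠ 0) {b t : F}
    (hb : f.comp (X + C b) = f + C t) : b = 0 := by
  obtain ⟨n, hfn⟩ : ∃ n, f.natDegree = n + 2 := ⟨f.natDegree - 2, by omega⟩
  have hcoef := congr_arg (fun p => p.coeff (n + 1)) hb
  have hlin : (hasseDeriv (n + 1) f).natDegree ≤ 1 :=
    (natDegree_hasseDeriv_le _ _).trans (by omega)
  have h0 : (hasseDeriv (n + 1) f).coeff 0 = f.coeff (n + 1) := by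
    rw [hasseDeriv_coeff]
    simp
  have h1 : (hasseDeriv (n + 1) f).coeff 1 = (f.natDegree : F) * f.leadingCoeff := by
    rw [hasseDeriv_coeff, leadingCoeff, hfn, add_comm 1 (n + 1), Nat.choose_succ_self_right]
  have heval : (hasseDeriv (n + 1) f).eval b
      = f.coeff (n + 1) + (f.natDegree : F) * f.leadingCoeff * b := by
    rw [eval_eq_sum_range' (Nat.lt_succ_of_le hlin)]
    simp [Finset.sum_range_succ, h0, h1]
  have hlead : f.leadingCoeff ≠ 0 := leadingCoeff_ne_zero.2 (by rintro rfl; simp at hf)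
  simp only [← taylor_apply, taylor_coeff, heval, coeff_add, coeff_C_succ, add_zero,
    add_eq_left, mul_eq_zero, hn, hlead, false_or] at hcoef
  exact hcoef

lemma IsAffineSymm.unique (hf : 1 < f.natDegree) (hn : (f.natDegree : F) ≠ 0) {a b b' : F}
    (hb : IsAffineSymm f a b) (hb' : IsAffineSymm f a b') : b = b' := by
  have ha := hb.1
  refine sub_eq_zero.1 (eq_zero_of_comp_X_add_C (t := b - b') hf hn ?_)
  have key : X + C (b - b') = (C a * X + C b).comp (C a⁻¹ * (X - C b')) := by
    simp only [add_comp, mul_comp, C_comp, X_comp, ← mul_assoc, ← C_mul, mul_inv_cancel₀ ha]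
    simp only [C_1, C_sub]
    ring
  have key' : (X : F[X]) = (C a * X + C b').comp (C a⁻¹ * (X - C b')) := by
    simp only [add_comp, mul_comp, C_comp, X_comp, ← mul_assoc, ← C_mul, mul_inv_cancel₀ ha]
    simp
  have hfb' : f = (C a * f + C b').comp (C a⁻¹ * (X - C b')) := by
    conv_lhs => rw [← comp_X (p := f), key', ← comp_assoc, hb'.2]
  rw [key, ← comp_assoc, hb.2]
  conv_rhs => rw [hfb']
  simp only [add_comp, mul_comp, C_comp, C_sub]
  ring

lemma IsAffineSymm.pow_eq_one (hf : 1 < f.natDegree) {a b : F} (hb : IsAffineSymm f a b) :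
    a ^ (f.natDegree - 1) = 1 := by
  have ha := hb.1
  have hlead : f.leadingCoeff ≠ 0 := leadingCoeff_ne_zero.2 (by rintro rfl; simp at hf)
  have hdeg : (C a * X + C b).natDegree = 1 := natDegree_linear ha
  have hl := congr_arg leadingCoeff hb.2
  have hlt : (C b).degree < (C a * f).degree := by
    refine degree_C_le.trans_lt ?_
    rw [degree_C_mul ha]
    exact natDegree_pos_iff_degree_pos.1 (by omega)
  rw [leadingCoeff_comp (by omega), leadingCoeff_linear ha, leadingCoeff_add_of_degree_lt' hlt,
    leadingCoeff_mul, leadingCoeff_C, mul_comm] at hl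
  have hpow := mul_right_cancel₀ hlead hl
  apply mul_right_cancel₀ ha
  rw [← pow_succ, Nat.sub_add_cancel (by omega), hpow, one_mul]

lemma smul_h_add_inj {a b a' b' : F}
    (heq : a • h q f g + algebraMap F _ b = a' • h q f g + algebraMap F _ b') : a = a' := by
  have : aeval (h q f g) (C a * X + C b) = aeval (h q f g) (C a' * X + C b') := by
    simpa [← Algebra.smul_def] using heq
  simpa using congr_arg (fun p => p.coeff 1) (aeval_h_injective this)

lemma algEquiv_ext {φ ψ : QGHA F q f g ≃ₐ[F] QGHA F q f g}
    (hx : φ (x q f g) = ψ (x q f g)) (hy : φ (y q f g) = ψ (y q f g))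
    (hh : φ (h q f g) = ψ (h q f g)) : φ = ψ := by
  ext u
  induction u using QGHA.induction with
  | hc r => rw [AlgEquiv.commutes, AlgEquiv.commutes]
  | hx => exact hx
  | hy => exact hy
  | hh => exact hh
  | hmul a b ha hb => rw [map_mul, map_mul, ha, hb]
  | hadd a b ha hb => rw [map_add, map_add, ha, hb]

lemma algEquiv_mul_apply_h {φ ψ : QGHA F q f g ≃ₐ[F] QGHA F q f g} {a b a' b' : F}
    (hφ : φ (h q f g) = a • h q f g + algebraMap F _ b)
    (hψ : ψ (h q f g) = a' • h q f g + algebraMap F _ b') :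
    (φ * ψ) (h q f g) = (a * a') • h q f g + algebraMap F _ (a' * b + b') := by
  rw [AlgEquiv.mul_apply, hψ, map_add, map_smul, hφ, AlgEquiv.commutes, smul_add, smul_smul,
    mul_comm a', map_add, map_mul, ← Algebra.smul_def, add_assoc]

lemma algEquiv_mul_comm (hq : q ≠ 0) (hf : 1 < f.natDegree) (hn : (f.natDegree : F) ≠ 0)
    (φ ψ : QGHA F q f g ≃ₐ[F] QGHA F q f g) : φ * ψ = ψ * φ := by
  apply algEquiv_ext
  · obtain ⟨a, -, ha⟩ := algEquiv_x hq hf φ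
    obtain ⟨b, -, hb⟩ := algEquiv_x hq hf ψ
    simp only [AlgEquiv.mul_apply, ha, hb, map_smul, smul_comm a b]
  · obtain ⟨a, ha⟩ := algEquiv_y hq hf φ
    obtain ⟨b, hb⟩ := algEquiv_y hq hf ψ
    simp only [AlgEquiv.mul_apply, ha, hb, map_smul, smul_comm a b]
  · obtain ⟨a, b, -, hφ⟩ := algEquiv_h_affine hq hf φ
    obtain ⟨a', b', -, hψ⟩ := algEquiv_h_affine hq hf ψ
    obtain ⟨c, d, hcd, hc⟩ := algEquiv_h_affine hq hf (φ * ψ)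
    obtain ⟨c', d', hcd', hc'⟩ := algEquiv_h_affine hq hf (ψ * φ)
    obtain rfl : c = a * a' := smul_h_add_inj (hc.symm.trans (algEquiv_mul_apply_h hφ hψ))
    obtain rfl : c' = a * a' := by
      rw [mul_comm]
      exact smul_h_add_inj (hc'.symm.trans (algEquiv_mul_apply_h hψ hφ))
    rw [hc, hc', hcd.unique hf hn hcd']

lemma algEquiv_eq_one (hq : q ≠ 0) (hf : 1 < f.natDegree) (hg : g ≠ 0)
    {φ : QGHA F q f g ≃ₐ[F] QGHA F q f g} (hx : φ (x q f g) = x q f g)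
    (hh : φ (h q f g) = h q f g) : φ = 1 := by
  obtain ⟨a, ha⟩ := algEquiv_y hq hf φ
  have hrel := congr_arg φ (y_mul_x q f g)
  rw [map_add, map_smul, map_mul, map_mul, ← aeval_algHom_apply, hx, hh, ha, smul_mul_assoc,
    y_mul_x, mul_smul_comm, smul_add, smul_comm a q, add_right_inj, ← map_smul] at hrel
  have hga := aeval_h_injective hrel
  have ha1 : a = 1 := by
    rw [← sub_eq_zero, ← smul_eq_zero_iff_left hg, sub_smul, hga, one_smul, sub_self]
  exact algEquiv_ext hx (by rw [ha, ha1, one_smul, AlgEquiv.one_apply]) hh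

/-- The coefficient of `h` in the image of `h`, as a character of the automorphism group. -/
lemma exists_character (hq : q ≠ 0) (hf : 1 < f.natDegree) :
    ∃ χ : (QGHA F q f g ≃ₐ[F] QGHA F q f g) →* rootsOfUnity (f.natDegree - 1) F,
      ∀ φ, ∃ b : F, IsAffineSymm f ((χ φ : Fˣ) : F) b ∧
        φ (h q f g) = ((χ φ : Fˣ) : F) • h q f g + algebraMap F _ b := by
  choose a b hab hφ using algEquiv_h_affine (g := g) hq hf
  refine ⟨⟨⟨fun φ => ⟨Units.mk0 (a φ) (hab φ).1, ?_⟩, ?_⟩, ?_⟩, fun φ => ⟨b φ, hab φ, hφ φ⟩⟩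
  · rw [mem_rootsOfUnity]
    ext
    simpa using (hab φ).pow_eq_one hf
  · ext
    refine smul_h_add_inj (b := b 1) (b' := 0) ((hφ 1).symm.trans ?_) (q := q) (f := f) (g := g)
    simp
  · intro φ ψ
    ext
    exact smul_h_add_inj ((hφ _).symm.trans (algEquiv_mul_apply_h (hφ φ) (hφ ψ)))

end QGHA

/-- Assume `char F = 0` or `char F > deg f`, `q ≠ 0`, `deg f > 1` and
`g ≠ 0`.  Then the subgroup `{φ ∈ Aut(H_q(f,g)) : φ(x) = x}` is a finite cyclic group
whose order divides `deg f − 1`; consequently `Aut(H_q(f,g))` is abelian. -/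
theorem qgha_aut_abelian {F : Type*} [Field F] (q : F) (f g : F[X])
    (hchar : ringChar F = 0 ∨ f.natDegree < ringChar F)
    (hq : q ≠ 0) (hf : 1 < f.degree) (hg : g ≠ 0) :
    (∃ B : Subgroup (QGHA F q f g ≃ₐ[F] QGHA F q f g),
      (B : Set (QGHA F q f g ≃ₐ[F] QGHA F q f g)) =
        {φ | φ (QGHA.x q f g) = QGHA.x q f g} ∧
      Finite B ∧ IsCyclic B ∧ Nat.card B ∣ f.natDegree - 1) ∧
    (∀ φ ψ : QGHA F q f g ≃ₐ[F] QGHA F q f g, φ * ψ = ψ * φ) := by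
  have hf1 : 1 < f.natDegree := by
    rcases eq_or_ne f 0 with rfl | hf0
    · simp at hf
    · rw [degree_eq_natDegree hf0] at hf
      exact_mod_cast hf
  have hn : (f.natDegree : F) ≠ 0 := by
    rw [Ne, ringChar.spec]
    rcases hchar with h0 | hlt
    · rw [h0, zero_dvd_iff]
      omega
    · exact Nat.not_dvd_of_pos_of_lt (by omega) hlt
  refine ⟨⟨MulAction.stabilizer _ (QGHA.x q f g), rfl, ?_⟩, QGHA.algEquiv_mul_comm hq hf1 hn⟩
  set B := MulAction.stabilizer (QGHA F q f g ≃ₐ[F] QGHA F q f g) (QGHA.x q f g)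
  obtain ⟨χ, hχ⟩ := QGHA.exists_character (g := g) hq hf1
  have hinj : Function.Injective (χ.comp B.subtype) := by
    rw [injective_iff_map_eq_one]
    rintro ⟨φ, hφ⟩ h1
    obtain ⟨b, hb, hh⟩ := hχ φ
    rw [show χ φ = 1 from h1] at hb hh
    have hb0 : b = 0 := hb.unique hf1 hn ⟨one_ne_zero, by simp⟩
    refine Subtype.ext (QGHA.algEquiv_eq_one hq hf1 hg hφ ?_)
    rw [hh, hb0]
    simp
  have : NeZero (f.natDegree - 1) := ⟨by omega⟩
  have hcyc : IsCyclic B := isCyclic_of_injective _ hinj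
  refine ⟨Finite.of_injective _ hinj, hcyc, ?_⟩
  rw [← IsCyclic.exponent_eq_card]
  refine Monoid.exponent_dvd_of_forall_pow_eq_one fun φ => hinj ?_
  rw [map_pow, map_one]
  exact Subtype.ext ((mem_rootsOfUnity _ _).1 (χ.comp B.subtype φ).2)
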